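/- arXiv:1905.12745 — 9 statements merged into one kernel-verified Lean document; each statement's English description precedes it below -/
import Mathlib

section
/- Let f : ℝ → ℝ be four times continuously differentiable (ContDiff ℝ 4 f), let x₀ ∈ ℝ, h > 0 and M ≥ 0, and suppose |iteratedDeriv 4 f ξ| ≤ M for every ξ ∈ [x₀ − h, x₀ + h]. Then the central finite-difference second-order derivative approximation satisfies the truncation bound |(f(x₀ + h) − 2·f(x₀) + f(x₀ − h))/h² − iteratedDeriv 2 f x₀| ≤ M·h²/12. -/
/-- Third-order Taylor expansion with Lagrange remainder, on either side of the base point. -/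
theorem exists_taylor_third_order_lagrange {f : ℝ → ℝ} (hf : ContDiff ℝ 4 f) {x₀ x : ℝ}
    (hx : x₀ ≠ x) :
    ∃ ξ ∈ Set.uIoo x₀ x, f x = f x₀ + deriv f x₀ * (x - x₀)
      + iteratedDeriv 2 f x₀ * (x - x₀) ^ 2 / 2 + iteratedDeriv 3 f x₀ * (x - x₀) ^ 3 / 6
      + iteratedDeriv 4 f ξ * (x - x₀) ^ 4 / 24 := by
  obtain ⟨ξ, hξ, h⟩ := taylor_mean_remainder_lagrange_iteratedDeriv (n := 3) hx
    (hf.of_le (by norm_num)).contDiffOn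
  refine ⟨ξ, hξ, ?_⟩
  have hderiv (k : ℕ) (hk : (k : WithTop ℕ∞) ≤ 4) :
      iteratedDerivWithin k f (Set.uIcc x₀ x) x₀ = iteratedDeriv k f x₀ :=
    iteratedDerivWithin_eq_iteratedDeriv (uniqueDiffOn_uIcc hx)
      (hf.of_le hk).contDiffAt Set.left_mem_uIcc
  rw [taylor_within_apply] at h
  simp only [Finset.sum_range_succ, Finset.sum_range_zero] at h
  rw [hderiv 0 (by norm_num), hderiv 1 (by norm_cast), hderiv 2 (by norm_cast),
    hderiv 3 (by norm_cast)] at h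
  norm_num [Nat.factorial, iteratedDeriv_one] at h
  linear_combination h

theorem central_fd_second_order_truncation
    (f : ℝ → ℝ) (hf : ContDiff ℝ 4 f) (x₀ h M : ℝ) (hh : 0 < h) (hM : 0 ≤ M)
    (hbound : ∀ ξ ∈ Set.Icc (x₀ - h) (x₀ + h), |iteratedDeriv 4 f ξ| ≤ M) :
    |(f (x₀ + h) - 2 * f x₀ + f (x₀ - h)) / h ^ 2 - iteratedDeriv 2 f x₀| ≤ M * h ^ 2 / 12 := by
  obtain ⟨ξ, hξ, hplus⟩ := exists_taylor_third_order_lagrange hf (x₀ := x₀) (x := x₀ + h)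
    (by linarith)
  obtain ⟨η, hη, hminus⟩ := exists_taylor_third_order_lagrange hf (x₀ := x₀) (x := x₀ - h)
    (by linarith)
  rw [Set.uIoo_of_le (by linarith)] at hξ
  rw [Set.uIoo_of_ge (by linarith)] at hη
  have hξM := hbound ξ ⟨by linarith [hξ.1], hξ.2.le⟩
  have hηM := hbound η ⟨hη.1.le, by linarith [hη.2]⟩
  have herror : (f (x₀ + h) - 2 * f x₀ + f (x₀ - h)) / h ^ 2 - iteratedDeriv 2 f x₀
      = (iteratedDeriv 4 f ξ + iteratedDeriv 4 f η) * (h ^ 2 / 24) := by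
    rw [hplus, hminus]
    field_simp
    ring
  calc
    _ = |iteratedDeriv 4 f ξ + iteratedDeriv 4 f η| * (h ^ 2 / 24) := by
      rw [herror, abs_mul, abs_of_nonneg (by positivity : 0 ≤ h ^ 2 / 24)]
    _ ≤ (M + M) * (h ^ 2 / 24) := by
      gcongr
      exact (abs_add_le _ _).trans (add_le_add hξM hηM)
    _ = M * h ^ 2 / 12 := by ring
end

section
/- Let g : ℝ × ℝ → ℝ be four times continuously differentiable (ContDiff ℝ 4 g), let (x₀, y₀) ∈ ℝ × ℝ, let h_x > 0, h_y > 0 and M ≥ 0, and suppose ‖iteratedFDeriv ℝ 4 g z‖ ≤ M for every z ∈ ℝ × ℝ. Then the four-point central finite-difference approximation of the second-order mixed partial derivative satisfies |(g(x₀ + h_x, y₀ + h_y) − g(x₀ + h_x, y₀ − h_y) − g(x₀ − h_x, y₀ + h_y) + g(x₀ − h_x, y₀ − h_y))/(4·h_x·h_y) − (iteratedFDeriv ℝ 2 g (x₀, y₀)) ![(1, 0), (0, 1)]| ≤ M·(h_x + h_y)⁴/(24·h_x·h_y). -/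
open scoped Nat in
/-- **Taylor's theorem** along a segment in a normed space, with an explicit remainder bound. -/
theorem norm_map_add_sub_sum_iteratedFDeriv_le {E F : Type*} [NormedAddCommGroup E]
    [NormedSpace ℝ E] [NormedAddCommGroup F] [NormedSpace ℝ F] [CompleteSpace F]
    {f : E → F} {n : ℕ} (hf : ContDiff ℝ (n + 1) f) {M : ℝ}
    (hM : ∀ z, ‖iteratedFDeriv ℝ (n + 1) f z‖ ≤ M) (x y : E) :
    ‖f (x + y) - ∑ k ∈ Finset.range (n + 1),
        (k ! : ℝ)⁻¹ • iteratedFDeriv ℝ k f x (fun _ ↦ y)‖ ≤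
      M * ‖y‖ ^ (n + 1) / (n + 1)! := by
  rw [map_add_eq_sum_add_integral_iteratedFDeriv (n := n) fun t _ ↦ hf.contDiffAt,
    add_sub_cancel_left, norm_smul]
  have hint : ‖∫ t in (0 : ℝ)..1,
      (1 - t) ^ n • iteratedFDeriv ℝ (n + 1) f (x + t • y) (fun _ ↦ y)‖ ≤
      ∫ t in (0 : ℝ)..1, (1 - t) ^ n * (M * ‖y‖ ^ (n + 1)) := by
    refine intervalIntegral.norm_integral_le_of_norm_le zero_le_one
      (Filter.Eventually.of_forall fun t ht ↦ ?_)
      (Continuous.intervalIntegrable (by fun_prop) _ _)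
    have ht' : 0 ≤ 1 - t := sub_nonneg.2 ht.2
    rw [norm_smul, Real.norm_of_nonneg (pow_nonneg ht' n)]
    gcongr
    refine (ContinuousMultilinearMap.le_opNorm _ _).trans ?_
    simp only [Finset.prod_const, Finset.card_univ, Fintype.card_fin]
    gcongr
    exact hM _
  have hval : ∫ t in (0 : ℝ)..1, (1 - t) ^ n * (M * ‖y‖ ^ (n + 1)) =
      M * ‖y‖ ^ (n + 1) / (n + 1) := by
    rw [intervalIntegral.integral_mul_const,
      intervalIntegral.integral_comp_sub_left (fun t ↦ t ^ n) (1 : ℝ), sub_self, sub_zero,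
      integral_pow]
    simp
    ring
  rw [hval] at hint
  calc ‖((n ! : ℝ))⁻¹‖ * _ ≤ ‖((n ! : ℝ))⁻¹‖ * (M * ‖y‖ ^ (n + 1) / (n + 1)) := by gcongr
    _ = M * ‖y‖ ^ (n + 1) / (n + 1)! := by
      rw [Real.norm_of_nonneg (by positivity), Nat.factorial_succ]
      push_cast
      field_simp

/-- The symmetric second difference approximates the second derivative to fourth order. -/
theorem abs_add_sub_iteratedFDeriv_two_le {E : Type*} [NormedAddCommGroup E]
    [NormedSpace ℝ E] {f : E → ℝ} (hf : ContDiff ℝ 4 f) {M : ℝ}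
    (hM : ∀ z, ‖iteratedFDeriv ℝ 4 f z‖ ≤ M) (x y : E) :
    |f (x + y) + f (x - y) - 2 * f x - fderiv ℝ (fderiv ℝ f) x y y| ≤ M * ‖y‖ ^ 4 / 12 := by
  have hf' : ContDiff ℝ ((3 : ℕ) + 1) f := by
    convert hf using 1
    norm_num
  have h₁ := norm_map_add_sub_sum_iteratedFDeriv_le hf' hM x y
  have h₂ := norm_map_add_sub_sum_iteratedFDeriv_le hf' hM x (-y)
  have h₃ : iteratedFDeriv ℝ 3 f x (fun _ ↦ -y) = -iteratedFDeriv ℝ 3 f x (fun _ ↦ y) := by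
    have := (iteratedFDeriv ℝ 3 f x).map_smul_univ (fun _ ↦ (-1 : ℝ)) (fun _ ↦ y)
    norm_num at this
    exact this
  simp only [Finset.sum_range_succ, Finset.sum_range_zero, Nat.factorial, norm_neg,
    iteratedFDeriv_two_apply, iteratedFDeriv_zero_apply, iteratedFDeriv_one_apply, h₃,
    Real.norm_eq_abs, smul_eq_mul, ← sub_eq_add_neg, map_neg, neg_apply]
    at h₁ h₂
  norm_num at h₁ h₂
  rw [abs_le] at *
  constructor <;> linarith

theorem central_fd_mixed_partial_truncation
    (g : ℝ × ℝ → ℝ) (hg : ContDiff ℝ 4 g) (x₀ y₀ hx hy M : ℝ)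
    (hhx : 0 < hx) (hhy : 0 < hy) (hM : 0 ≤ M)
    (hbound : ∀ z : ℝ × ℝ, ‖iteratedFDeriv ℝ 4 g z‖ ≤ M) :
    |(g (x₀ + hx, y₀ + hy) - g (x₀ + hx, y₀ - hy) - g (x₀ - hx, y₀ + hy)
        + g (x₀ - hx, y₀ - hy)) / (4 * hx * hy)
      - iteratedFDeriv ℝ 2 g (x₀, y₀) ![((1 : ℝ), (0 : ℝ)), ((0 : ℝ), (1 : ℝ))]|
      ≤ M * (hx + hy) ^ 4 / (24 * hx * hy) := by
  have hsymm : IsSymmSndFDerivAt ℝ g (x₀, y₀) :=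
    hg.contDiffAt.isSymmSndFDerivAt (by simp; norm_num)
  have h₁ := abs_add_sub_iteratedFDeriv_two_le hg hbound (x₀, y₀) (hx, hy)
  have h₂ := abs_add_sub_iteratedFDeriv_two_le hg hbound (x₀, y₀) (hx, -hy)
  have hn₁ : ‖(hx, hy)‖ ≤ hx + hy := by
    simp [Prod.norm_def, abs_of_pos hhx, abs_of_pos hhy, hhx.le, hhy.le]
  have hn₂ : ‖(hx, -hy)‖ ≤ hx + hy := by
    simp [Prod.norm_def, abs_of_pos hhx, abs_of_pos hhy, hhx.le, hhy.le]
  have hb₁ : M * ‖(hx, hy)‖ ^ 4 ≤ M * (hx + hy) ^ 4 := by gcongr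
  have hb₂ : M * ‖(hx, -hy)‖ ^ 4 ≤ M * (hx + hy) ^ 4 := by gcongr
  have hv (s t : ℝ) : (s, t) = s • ((1 : ℝ), (0 : ℝ)) + t • ((0 : ℝ), (1 : ℝ)) := by simp
  have hD (s t : ℝ) : fderiv ℝ (fderiv ℝ g) (x₀, y₀) (s, t) (s, t) =
      s ^ 2 * fderiv ℝ (fderiv ℝ g) (x₀, y₀) (1, 0) (1, 0) +
      2 * s * t * fderiv ℝ (fderiv ℝ g) (x₀, y₀) (1, 0) (0, 1) +
      t ^ 2 * fderiv ℝ (fderiv ℝ g) (x₀, y₀) (0, 1) (0, 1) := by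
    rw [hv s t]
    simp only [map_add, map_smul, add_apply, smul_apply,
      smul_eq_mul, hsymm.eq (0, 1) (1, 0)]
    ring
  rw [hD] at h₁ h₂
  simp only [Prod.mk_add_mk, Prod.mk_sub_mk, sub_neg_eq_add, ← sub_eq_add_neg] at h₁ h₂
  rw [iteratedFDeriv_two_apply, div_sub' (by positivity), abs_div,
    abs_of_pos (show 0 < 4 * hx * hy by positivity), div_le_div_iff₀ (by positivity)
      (by positivity)]
  simp only [Matrix.cons_val_zero, Matrix.cons_val_one]
  set D := fderiv ℝ (fderiv ℝ g) (x₀, y₀) (1, 0) (0, 1)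
  have key : |g (x₀ + hx, y₀ + hy) - g (x₀ + hx, y₀ - hy) - g (x₀ - hx, y₀ + hy)
      + g (x₀ - hx, y₀ - hy) - 4 * hx * hy * D| ≤ M * (hx + hy) ^ 4 / 6 := by
    rw [abs_le] at *
    constructor <;> linarith
  calc _ ≤ M * (hx + hy) ^ 4 / 6 * (24 * hx * hy) := by gcongr
    _ = _ := by ring
end

section
/- For every real polynomial p : ℝ[X] and all x, h : ℝ, evaluating p at the hyper-dual point x + h·ε₁ + h·ε₂ gives the exact truncated Taylor expansion: Polynomial.aeval (algebraMap ℝ H x + h • ε₁ + h • ε₂) p = algebraMap ℝ H (p.eval x) + (h * p.derivative.eval x) • ε₁ + (h * p.derivative.eval x) • ε₂ + (h^2 * (p.derivative.derivative).eval x) • (ε₁ * ε₂). In particular there is no truncation error beyond second order. -/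
set_option synthInstance.maxHeartbeats 1000000
set_option maxHeartbeats 1000000

open TrivSqZeroExt

/-- The hyper-dual numbers. -/
noncomputable abbrev HyperDual : Type := DualNumber (DualNumber ℝ)

/-- The first hyper-dual imaginary unit `ε₁`. -/
noncomputable def eps₁ : HyperDual := TrivSqZeroExt.inl DualNumber.eps

/-- The second hyper-dual imaginary unit `ε₂`. -/
noncomputable def eps₂ : HyperDual := DualNumber.eps

/-- Evaluating a polynomial at a point perturbed by two square-zero elements of a commutative
algebra gives its exact second-order Taylor expansion. -/
theorem aeval_add_smul_add_smul_of_mul_self_eq_zero {R A : Type*} [CommRing R] [CommRing A]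
    [Algebra R A] {a b : A} (ha : a * a = 0) (hb : b * b = 0) (p : Polynomial R) (x h : R) :
    Polynomial.aeval (algebraMap R A x + h • a + h • b) p =
      algebraMap R A (p.eval x)
        + (h * p.derivative.eval x) • a
        + (h * p.derivative.eval x) • b
        + (h ^ 2 * (p.derivative.derivative).eval x) • (a * b) := by
  induction p using Polynomial.induction_on with
  | C r => simp
  | add p q hp hq =>
    simp only [map_add, Polynomial.eval_add, hp, hq, mul_add, add_smul]
    ring
  | monomial n r ih =>
    rw [pow_succ, ← mul_assoc, map_mul, ih, Polynomial.aeval_X]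
    generalize Polynomial.C r * Polynomial.X ^ n = q
    simp only [Polynomial.derivative_mul, Polynomial.derivative_X, Polynomial.eval_add,
      Polynomial.eval_mul, Polynomial.eval_X, mul_one, Algebra.smul_def, map_add, map_mul, map_pow]
    generalize algebraMap R A (q.eval x) = u
    generalize algebraMap R A (q.derivative.eval x) = v
    generalize algebraMap R A (q.derivative.derivative.eval x) = w
    generalize algebraMap R A h = k
    linear_combination (k ^ 2 * v + k ^ 3 * w * b) * ha + (k ^ 2 * v + k ^ 3 * w * a) * hb

theorem hyperdual_polynomial_eval
    (p : Polynomial ℝ) (x h : ℝ) :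
    Polynomial.aeval (algebraMap ℝ HyperDual x + h • eps₁ + h • eps₂) p =
      algebraMap ℝ HyperDual (p.eval x)
        + (h * p.derivative.eval x) • eps₁
        + (h * p.derivative.eval x) • eps₂
        + (h ^ 2 * (p.derivative.derivative).eval x) • (eps₁ * eps₂) := by
  have h₁ : eps₁ * eps₁ = 0 := by
    unfold eps₁
    rw [← TrivSqZeroExt.inl_mul, DualNumber.eps_mul_eps, TrivSqZeroExt.inl_zero]
  have h₂ : eps₂ * eps₂ = 0 := DualNumber.eps_mul_eps
  exact aeval_add_smul_add_smul_of_mul_self_eq_zero (A := HyperDual) h₁ h₂ p x h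
end

section
/- For every real polynomial p : ℝ[X], all x : ℝ and all nonzero h : ℝ, the hyper-dual first-derivative approximation is exact: writing w := Polynomial.aeval (algebraMap ℝ H x + h • ε₁ + h • ε₂) p, one has Ep₁(w) = Ep₂(w) and Ep₁(w)/h = p.derivative.eval x, exactly and for every choice of step size h ≠ 0. -/
set_option synthInstance.maxHeartbeats 1000000
set_option maxHeartbeats 1000000

open TrivSqZeroExt

theorem HyperDual.aeval_components (p : Polynomial ℝ) (w : HyperDual) :
    (Polynomial.aeval w p).fst.fst = p.eval w.fst.fst ∧
    (Polynomial.aeval w p).fst.snd = w.fst.snd * p.derivative.eval w.fst.fst ∧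
    (Polynomial.aeval w p).snd.fst = w.snd.fst * p.derivative.eval w.fst.fst := by
  induction p using Polynomial.induction_on with
  | C a => simp [TrivSqZeroExt.algebraMap_eq_inl']
  | add p q hp hq =>
    simp only [map_add, TrivSqZeroExt.fst_add, TrivSqZeroExt.snd_add, Polynomial.eval_add, hp, hq,
      mul_add, and_self]
  | monomial n a ih =>
    obtain ⟨h₀, h₁, h₂⟩ := ih
    rw [pow_succ, ← mul_assoc, map_mul, Polynomial.aeval_X, Polynomial.derivative_mul,
      Polynomial.derivative_X]
    generalize Polynomial.aeval w (Polynomial.C a * Polynomial.X ^ n) = v at *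
    generalize Polynomial.C a * Polynomial.X ^ n = q at *
    simp only [TrivSqZeroExt.fst_mul, TrivSqZeroExt.snd_mul, TrivSqZeroExt.fst_add,
      smul_eq_mul, MulOpposite.smul_eq_mul_unop, MulOpposite.unop_op,
      Polynomial.eval_add, Polynomial.eval_mul, Polynomial.eval_X, Polynomial.eval_one, h₀, h₁, h₂]
    refine ⟨trivial, ?_, ?_⟩ <;> ring

theorem hyperdual_first_derivative_exact
    (p : Polynomial ℝ) (x h : ℝ) (hh : h ≠ 0) :
    (Polynomial.aeval (algebraMap ℝ HyperDual x + h • eps₁ + h • eps₂) p).fst.snd =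
      (Polynomial.aeval (algebraMap ℝ HyperDual x + h • eps₁ + h • eps₂) p).snd.fst ∧
    (Polynomial.aeval (algebraMap ℝ HyperDual x + h • eps₁ + h • eps₂) p).fst.snd / h =
      p.derivative.eval x := by
  have key := HyperDual.aeval_components p (algebraMap ℝ HyperDual x + h • eps₁ + h • eps₂)
  have h₀ : (algebraMap ℝ HyperDual x + h • eps₁ + h • eps₂).fst.fst = x := by
    simp [eps₁, eps₂, TrivSqZeroExt.algebraMap_eq_inl']
  have h₁ : (algebraMap ℝ HyperDual x + h • eps₁ + h • eps₂).fst.snd = h := by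
    simp [eps₁, eps₂, TrivSqZeroExt.algebraMap_eq_inl']
  have h₂ : (algebraMap ℝ HyperDual x + h • eps₁ + h • eps₂).snd.fst = h := by
    simp [eps₁, eps₂, TrivSqZeroExt.algebraMap_eq_inl']
  rw [h₀, h₁, h₂] at key
  obtain ⟨-, k₁, k₂⟩ := key
  rw [k₁, k₂]
  exact ⟨rfl, mul_div_cancel_left₀ _ hh⟩
end

section
/- For every real polynomial p : ℝ[X], all x : ℝ and all nonzero h : ℝ, the hyper-dual second-derivative approximation is exact and insensitive to the step size: writing w := Polynomial.aeval (algebraMap ℝ H x + h • ε₁ + h • ε₂) p, one has Ep₁₂(w)/h² = (p.derivative.derivative).eval x, with no truncation error, for every choice of h ≠ 0. -/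
set_option synthInstance.maxHeartbeats 1000000
set_option maxHeartbeats 1000000

open TrivSqZeroExt

/-- The components of a real polynomial evaluated at `x + h ε₁ + h ε₂` are its value and scaled
derivatives at `x`. -/
theorem aeval_hyperDual_components (p : Polynomial ℝ) (x h : ℝ) :
    (Polynomial.aeval (algebraMap ℝ HyperDual x + h • eps₁ + h • eps₂) p).fst.fst = p.eval x ∧
    (Polynomial.aeval (algebraMap ℝ HyperDual x + h • eps₁ + h • eps₂) p).fst.snd =
      h * p.derivative.eval x ∧
    (Polynomial.aeval (algebraMap ℝ HyperDual x + h • eps₁ + h • eps₂) p).snd.fst =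
      h * p.derivative.eval x ∧
    (Polynomial.aeval (algebraMap ℝ HyperDual x + h • eps₁ + h • eps₂) p).snd.snd =
      h ^ 2 * p.derivative.derivative.eval x := by
  have hw₁ : (algebraMap ℝ HyperDual x + h • eps₁ + h • eps₂).fst.fst = x := by
    simp [eps₁, eps₂, algebraMap_eq_inl']
  have hw₂ : (algebraMap ℝ HyperDual x + h • eps₁ + h • eps₂).fst.snd = h := by
    simp [eps₁, eps₂, algebraMap_eq_inl']
  have hw₃ : (algebraMap ℝ HyperDual x + h • eps₁ + h • eps₂).snd.fst = h := by
    simp [eps₁, eps₂, algebraMap_eq_inl']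
  have hw₄ : (algebraMap ℝ HyperDual x + h • eps₁ + h • eps₂).snd.snd = 0 := by
    simp [eps₁, eps₂, algebraMap_eq_inl']
  generalize algebraMap ℝ HyperDual x + h • eps₁ + h • eps₂ = w at *
  induction p using Polynomial.induction_on with
  | C a => simp [algebraMap_eq_inl']
  | add p q hp hq =>
    obtain ⟨hp₁, hp₂, hp₃, hp₄⟩ := hp
    obtain ⟨hq₁, hq₂, hq₃, hq₄⟩ := hq
    simp only [map_add, fst_add, snd_add, Polynomial.eval_add, hp₁, hp₂, hp₃, hp₄, hq₁, hq₂, hq₃,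
      hq₄]
    refine ⟨trivial, ?_, ?_, ?_⟩ <;> ring
  | monomial n a ih =>
    rw [pow_succ, ← mul_assoc]
    generalize Polynomial.C a * Polynomial.X ^ n = q at ih ⊢
    obtain ⟨h₁, h₂, h₃, h₄⟩ := ih
    simp only [map_mul, Polynomial.aeval_X, Polynomial.derivative_mul, Polynomial.derivative_X,
      map_add, mul_one, Polynomial.eval_add, Polynomial.eval_mul, Polynomial.eval_X, fst_mul,
      snd_mul, fst_add, snd_add, smul_eq_mul, op_smul_eq_smul, h₁, h₂, h₃, h₄, hw₁, hw₂,
      hw₃, hw₄]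
    refine ⟨trivial, ?_, ?_, ?_⟩ <;> ring

theorem hyperdual_second_derivative_exact
    (p : Polynomial ℝ) (x h : ℝ) (hh : h ≠ 0) :
    (Polynomial.aeval (algebraMap ℝ HyperDual x + h • eps₁ + h • eps₂) p).snd.snd / h ^ 2 =
      (p.derivative.derivative).eval x := by
  rw [(aeval_hyperDual_components p x h).2.2.2]
  exact mul_div_cancel_left₀ _ (pow_ne_zero 2 hh)
end

section
/- For every bivariate real polynomial p : MvPolynomial (Fin 2) ℝ and all x, y, h : ℝ, evaluating p at the hyper-dual input (x + h·ε₁, y + h·ε₂) gives the exact expansion: MvPolynomial.aeval φ p = algebraMap ℝ H (eval p at (x,y)) + (h * eval (∂₀ p) at (x,y)) • ε₁ + (h * eval (∂₁ p) at (x,y)) • ε₂ + (h^2 * eval (∂₀ (∂₁ p)) at (x,y)) • (ε₁ * ε₂), where φ : Fin 2 → H is defined by φ 0 = algebraMap ℝ H x + h • ε₁ and φ 1 = algebraMap ℝ H y + h • ε₂. -/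
set_option synthInstance.maxHeartbeats 1000000
set_option maxHeartbeats 1000000

open TrivSqZeroExt

/-- Evaluating a bivariate polynomial at a point perturbed by multiples of square-zero elements
`a` and `b` gives its exact mixed second-order expansion. -/
theorem MvPolynomial.aeval_add_smul_of_mul_self_eq_zero {R A : Type*} [CommRing R] [CommRing A]
    [Algebra R A] (p : MvPolynomial (Fin 2) R) (x y h : R) {a b : A}
    (ha : a * a = 0) (hb : b * b = 0) :
    aeval ![algebraMap R A x + h • a, algebraMap R A y + h • b] p =
      algebraMap R A (eval ![x, y] p)
        + (h * eval ![x, y] (pderiv 0 p)) • a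
        + (h * eval ![x, y] (pderiv 1 p)) • b
        + (h ^ 2 * eval ![x, y] (pderiv 0 (pderiv 1 p))) • (a * b) := by
  simp only [Algebra.smul_def, map_mul, map_pow]
  set c := algebraMap R A
  induction p using MvPolynomial.induction_on with
  | C r => simp [c]
  | add p q hp hq =>
    simp only [map_add, hp, hq]
    ring
  | mul_X p i hp =>
    rw [map_mul, hp, aeval_X]
    fin_cases i
    · simp [Derivation.leibniz, pderiv_X]
      linear_combination
        c h ^ 2 * (c (eval ![x, y] (pderiv 0 p))
          + c h * c (eval ![x, y] (pderiv 0 (pderiv 1 p))) * b) * ha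
    · simp [Derivation.leibniz, pderiv_X]
      linear_combination
        c h ^ 2 * (c (eval ![x, y] (pderiv 1 p))
          + c h * c (eval ![x, y] (pderiv 0 (pderiv 1 p))) * a) * hb

theorem eps₁_mul_eps₁ : eps₁ * eps₁ = 0 := by
  rw [eps₁, ← inl_mul, DualNumber.eps_mul_eps, inl_zero]

theorem eps₂_mul_eps₂ : eps₂ * eps₂ = 0 :=
  DualNumber.eps_mul_eps

theorem hyperdual_mv_polynomial_eval
    (p : MvPolynomial (Fin 2) ℝ) (x y h : ℝ) (φ : Fin 2 → HyperDual)
    (hφ0 : φ 0 = algebraMap ℝ HyperDual x + h • eps₁)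
    (hφ1 : φ 1 = algebraMap ℝ HyperDual y + h • eps₂) :
    MvPolynomial.aeval φ p =
      algebraMap ℝ HyperDual (MvPolynomial.eval ![x, y] p)
        + (h * MvPolynomial.eval ![x, y] (MvPolynomial.pderiv 0 p)) • eps₁
        + (h * MvPolynomial.eval ![x, y] (MvPolynomial.pderiv 1 p)) • eps₂
        + (h ^ 2 * MvPolynomial.eval ![x, y] (MvPolynomial.pderiv 0 (MvPolynomial.pderiv 1 p)))
            • (eps₁ * eps₂) := by
  have hφ : φ = ![algebraMap ℝ HyperDual x + h • eps₁, algebraMap ℝ HyperDual y + h • eps₂] := by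
    ext1 i
    fin_cases i
    · exact hφ0
    · exact hφ1
  subst hφ
  exact MvPolynomial.aeval_add_smul_of_mul_self_eq_zero (A := HyperDual) p x y h
    eps₁_mul_eps₁ eps₂_mul_eps₂
end

section
/- For every bivariate real polynomial p : MvPolynomial (Fin 2) ℝ, all x, y : ℝ and all nonzero h : ℝ, the hyper-dual mixed second-partial-derivative approximation is exact: writing w := MvPolynomial.aeval φ p with φ 0 = algebraMap ℝ H x + h • ε₁ and φ 1 = algebraMap ℝ H y + h • ε₂, one has Ep₁₂(w)/h² = eval (∂₀ (∂₁ p)) at (x,y), exactly, for every h ≠ 0. -/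
set_option synthInstance.maxHeartbeats 1000000
set_option maxHeartbeats 1000000

open TrivSqZeroExt

lemma aeval_hyperDual_components_s7
    (p : MvPolynomial (Fin 2) ℝ) (x y h : ℝ) (φ : Fin 2 → HyperDual)
    (hφ0 : φ 0 = algebraMap ℝ HyperDual x + h • eps₁)
    (hφ1 : φ 1 = algebraMap ℝ HyperDual y + h • eps₂) :
    (MvPolynomial.aeval φ p).fst.fst = MvPolynomial.eval ![x, y] p ∧
    (MvPolynomial.aeval φ p).fst.snd =
      h * MvPolynomial.eval ![x, y] (MvPolynomial.pderiv 0 p) ∧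
    (MvPolynomial.aeval φ p).snd.fst =
      h * MvPolynomial.eval ![x, y] (MvPolynomial.pderiv 1 p) ∧
    (MvPolynomial.aeval φ p).snd.snd =
      h ^ 2 * MvPolynomial.eval ![x, y] (MvPolynomial.pderiv 0 (MvPolynomial.pderiv 1 p)) := by
  induction p using MvPolynomial.induction_on with
  | C a => simp [TrivSqZeroExt.algebraMap_eq_inl']
  | add p q hp hq =>
    obtain ⟨hp₀, hp₁, hp₂, hp₃⟩ := hp
    obtain ⟨hq₀, hq₁, hq₂, hq₃⟩ := hq
    simp only [map_add, fst_add, snd_add, hp₀, hp₁, hp₂, hp₃, hq₀, hq₁, hq₂, hq₃, mul_add,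
      and_self]
  | mul_X p i hp =>
    obtain ⟨hp₀, hp₁, hp₂, hp₃⟩ := hp
    fin_cases i
    · simp [hφ0, eps₁, hp₀, hp₁, hp₂, hp₃, TrivSqZeroExt.algebraMap_eq_inl',
        MvPolynomial.pderiv_X, Derivation.leibniz]
      refine ⟨?_, ?_, ?_⟩ <;> ring
    · simp [hφ1, eps₂, hp₀, hp₁, hp₂, hp₃, TrivSqZeroExt.algebraMap_eq_inl',
        MvPolynomial.pderiv_X, Derivation.leibniz]
      refine ⟨?_, ?_, ?_⟩ <;> ring

theorem hyperdual_mixed_partial_exact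
    (p : MvPolynomial (Fin 2) ℝ) (x y h : ℝ) (hh : h ≠ 0) (φ : Fin 2 → HyperDual)
    (hφ0 : φ 0 = algebraMap ℝ HyperDual x + h • eps₁)
    (hφ1 : φ 1 = algebraMap ℝ HyperDual y + h • eps₂) :
    (MvPolynomial.aeval φ p).snd.snd / h ^ 2 =
      MvPolynomial.eval ![x, y] (MvPolynomial.pderiv 0 (MvPolynomial.pderiv 1 p)) := by
  rw [(aeval_hyperDual_components_s7 p x y h φ hφ0 hφ1).2.2.2]
  exact mul_div_cancel_left₀ _ (pow_ne_zero 2 hh)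
end

section
/- A single hyper-dual function evaluation yields two exact first-order partial derivatives simultaneously: for every bivariate real polynomial p : MvPolynomial (Fin 2) ℝ, all x, y : ℝ and all nonzero h : ℝ, writing w := MvPolynomial.aeval φ p with φ 0 = algebraMap ℝ H x + h • ε₁ and φ 1 = algebraMap ℝ H y + h • ε₂, one has Ep₁(w)/h = eval (∂₀ p) at (x,y) and Ep₂(w)/h = eval (∂₁ p) at (x,y), exactly, for every h ≠ 0. -/
set_option synthInstance.maxHeartbeats 1000000
set_option maxHeartbeats 1000000

open TrivSqZeroExt

/-- Evaluating a polynomial at hyper-dual perturbations of `x` and `y` gives the value of the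
polynomial as real part and `h` times the partial derivatives as `ε₁`- and `ε₂`-parts. -/
theorem aeval_hyperDual_parts
    (p : MvPolynomial (Fin 2) ℝ) (x y h : ℝ) (φ : Fin 2 → HyperDual)
    (hφ0 : φ 0 = algebraMap ℝ HyperDual x + h • eps₁)
    (hφ1 : φ 1 = algebraMap ℝ HyperDual y + h • eps₂) :
    (MvPolynomial.aeval φ p).fst.fst = MvPolynomial.eval ![x, y] p ∧
    (MvPolynomial.aeval φ p).fst.snd =
        h * MvPolynomial.eval ![x, y] (MvPolynomial.pderiv 0 p) ∧
    (MvPolynomial.aeval φ p).snd.fst =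
        h * MvPolynomial.eval ![x, y] (MvPolynomial.pderiv 1 p) := by
  induction p using MvPolynomial.induction_on with
  | C a => simp [TrivSqZeroExt.algebraMap_eq_inl']
  | add p q hp hq =>
    obtain ⟨hp, hp₁, hp₂⟩ := hp
    obtain ⟨hq, hq₁, hq₂⟩ := hq
    simp [hp, hp₁, hp₂, hq, hq₁, hq₂, mul_add]
  | mul_X p i hp =>
    obtain ⟨hp, hp₁, hp₂⟩ := hp
    fin_cases i <;>
      simp [hφ0, hφ1, eps₁, eps₂, TrivSqZeroExt.algebraMap_eq_inl', hp, hp₁, hp₂,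
        MvPolynomial.pderiv_X] <;>
      ring_nf <;> simp

theorem hyperdual_two_first_partials_exact
    (p : MvPolynomial (Fin 2) ℝ) (x y h : ℝ) (hh : h ≠ 0) (φ : Fin 2 → HyperDual)
    (hφ0 : φ 0 = algebraMap ℝ HyperDual x + h • eps₁)
    (hφ1 : φ 1 = algebraMap ℝ HyperDual y + h • eps₂) :
    (MvPolynomial.aeval φ p).fst.snd / h =
        MvPolynomial.eval ![x, y] (MvPolynomial.pderiv 0 p) ∧
    (MvPolynomial.aeval φ p).snd.fst / h =
        MvPolynomial.eval ![x, y] (MvPolynomial.pderiv 1 p) := by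
  obtain ⟨-, h₁, h₂⟩ := aeval_hyperDual_parts p x y h φ hφ0 hφ1
  rw [h₁, h₂]
  exact ⟨mul_div_cancel_left₀ _ hh, mul_div_cancel_left₀ _ hh⟩
end

section
/- For every bivariate real polynomial p : MvPolynomial (Fin 2) ℝ, all x, y : ℝ and all nonzero h : ℝ, the hyper-dual pure second-partial-derivative approximation is exact: writing w := MvPolynomial.aeval ψ p with ψ 0 = algebraMap ℝ H x + h • ε₁ + h • ε₂ and ψ 1 = algebraMap ℝ H y, one has Ep₁₂(w)/h² = eval (∂₀ (∂₀ p)) at (x,y), exactly, for every h ≠ 0. -/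
set_option synthInstance.maxHeartbeats 1000000
set_option maxHeartbeats 1000000

open TrivSqZeroExt

/-- The four real components of a bivariate polynomial evaluated at
`(x + h ε₁ + h ε₂, y)`. -/
theorem HyperDual.aeval_components_s9
    (p : MvPolynomial (Fin 2) ℝ) (x y h : ℝ) (ψ : Fin 2 → HyperDual)
    (hψ0 : ψ 0 = algebraMap ℝ HyperDual x + h • eps₁ + h • eps₂)
    (hψ1 : ψ 1 = algebraMap ℝ HyperDual y) :
    (MvPolynomial.aeval ψ p).fst.fst = MvPolynomial.eval ![x, y] p ∧
    (MvPolynomial.aeval ψ p).fst.snd =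
      h * MvPolynomial.eval ![x, y] (MvPolynomial.pderiv 0 p) ∧
    (MvPolynomial.aeval ψ p).snd.fst =
      h * MvPolynomial.eval ![x, y] (MvPolynomial.pderiv 0 p) ∧
    (MvPolynomial.aeval ψ p).snd.snd =
      h ^ 2 * MvPolynomial.eval ![x, y] (MvPolynomial.pderiv 0 (MvPolynomial.pderiv 0 p)) := by
  induction p using MvPolynomial.induction_on with
  | C a => simp [algebraMap_eq_inl']
  | add p q hp hq =>
    obtain ⟨hp₀, hp₁, hp₂, hp₁₂⟩ := hp
    obtain ⟨hq₀, hq₁, hq₂, hq₁₂⟩ := hq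
    simp only [map_add, fst_add, snd_add, hp₀, hp₁, hp₂, hp₁₂, hq₀, hq₁, hq₂, hq₁₂, mul_add,
      and_self]
  | mul_X p i hp =>
    obtain ⟨hp₀, hp₁, hp₂, hp₁₂⟩ := hp
    fin_cases i
    · simp [hψ0, hp₀, hp₁, hp₂, hp₁₂, eps₁, eps₂, algebraMap_eq_inl',
        Derivation.leibniz]
      refine ⟨?_, ?_, ?_⟩ <;> ring
    · simp [hψ1, hp₀, hp₁, hp₂, hp₁₂, algebraMap_eq_inl', Derivation.leibniz,
        MvPolynomial.pderiv_X]
      constructor <;> ring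

theorem hyperdual_pure_second_partial_exact
    (p : MvPolynomial (Fin 2) ℝ) (x y h : ℝ) (hh : h ≠ 0) (ψ : Fin 2 → HyperDual)
    (hψ0 : ψ 0 = algebraMap ℝ HyperDual x + h • eps₁ + h • eps₂)
    (hψ1 : ψ 1 = algebraMap ℝ HyperDual y) :
    (MvPolynomial.aeval ψ p).snd.snd / h ^ 2 =
      MvPolynomial.eval ![x, y] (MvPolynomial.pderiv 0 (MvPolynomial.pderiv 0 p)) := by
  rw [(HyperDual.aeval_components_s9 p x y h ψ hψ0 hψ1).2.2.2]
  exact mul_div_cancel_left₀ _ (pow_ne_zero 2 hh)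
end
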